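/- arXiv:math/9401208 — 2 statements merged into one kernel-verified Lean document; each statement's English description precedes it below -/
import Mathlib

section
/- Let λ ∈ ℂ. If z⁽⁰⁾ ∈ ℓ²(ℕ, ℂ) satisfies (λI − A) z⁽⁰⁾ = e_0, then z⁽¹⁾ = −(e_0 − (λ − b_0) z⁽⁰⁾)/a_1 satisfies (λI − A) z⁽¹⁾ = e_1; consequently, if e_0 lies in the range of λI − A, then e_n lies in the range of λI − A for every n ≥ 0. -/
/-- If `A` acts tridiagonally on a sequence `g` with nonvanishing `α`, a submodule containing the
range of `c - A` and `g 0` contains every `g n`. -/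
theorem mem_of_tridiagonal {K M : Type*} [Field K] [AddCommGroup M] [Module K M]
    {α β γ : ℕ → K} (hα : ∀ k, α k ≠ 0) {A : M → M} {g : ℕ → M}
    (hA0 : A (g 0) = β 0 • g 0 + α 1 • g 1)
    (hAn : ∀ n, 1 ≤ n → A (g n) = γ (n - 1) • g (n - 1) + β n • g n + α (n + 1) • g (n + 1))
    (c : K) (R : Submodule K M) (hR : ∀ x, c • x - A x ∈ R) (h0 : g 0 ∈ R) (n : ℕ) :
    g n ∈ R := by
  induction n using Nat.strong_induction_on with
  | _ n ih =>
    rcases n with _ | _ | n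
    · exact h0
    · refine (R.smul_mem_iff (hα 1)).mp ?_
      have h := R.sub_mem (R.smul_mem (c - β 0) h0) (hR (g 0))
      rw [hA0] at h
      convert h using 1
      module
    · refine (R.smul_mem_iff (hα (n + 2))).mp ?_
      have h := R.sub_mem (R.sub_mem (R.smul_mem (c - β (n + 1)) (ih (n + 1) (by omega)))
        (R.smul_mem (γ n) (ih n (by omega)))) (hR (g (n + 1)))
      rw [hAn (n + 1) (by omega), Nat.add_sub_cancel] at h
      convert h using 1
      module

/-- If `(λ I - A) z⁰ = e 0`, then `z¹ = -(e 0 - (λ - b 0) • z⁰)/a 1` satisfies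
`(λ I - A) z¹ = e 1`; consequently if `e 0` is in the range of `λ I - A` then so is
every `e n`. -/
theorem range_step
    (α β γ : ℕ → ℂ) (hα : ∀ k, α k ≠ 0) (hγ : ∀ k, γ k ≠ 0)
    (A : lp (fun _ : ℕ => ℂ) 2 →L[ℂ] lp (fun _ : ℕ => ℂ) 2)
    (g : ℕ → lp (fun _ : ℕ => ℂ) 2) (hg : ∀ n, g n = lp.single 2 n (1 : ℂ))
    (hA0 : A (g 0) = β 0 • g 0 + α 1 • g 1)
    (hAn : ∀ n, 1 ≤ n → A (g n) = γ (n - 1) • g (n - 1) + β n • g n + α (n + 1) • g (n + 1))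
    (a b : ℕ → ℂ) (ha : ∀ n, a n = α n * γ (n - 1)) (hb : ∀ n, b n = β n)
    (d : ℕ → ℂ) (hd : ∀ n, d n = ∏ k ∈ Finset.range n, γ k)
    (e : ℕ → lp (fun _ : ℕ => ℂ) 2) (he : ∀ n, e n = (d n)⁻¹ • g n)
    (lam : ℂ) :
    (∀ z₀ : lp (fun _ : ℕ => ℂ) 2, lam • z₀ - A z₀ = e 0 →
        lam • (-(a 1)⁻¹ • (e 0 - (lam - b 0) • z₀)) - A (-(a 1)⁻¹ • (e 0 - (lam - b 0) • z₀))
          = e 1) ∧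
      ((∃ z : lp (fun _ : ℕ => ℂ) 2, lam • z - A z = e 0) →
        ∀ n : ℕ, ∃ z : lp (fun _ : ℕ => ℂ) 2, lam • z - A z = e n) := by
  have he0 : e 0 = g 0 := by simp [he, hd]
  have he1 : a 1 • e 1 = α 1 • g 1 := by
    rw [he, hd, ha, smul_smul]
    simp [hγ 0]
  have ha1 : a 1 ≠ 0 := by
    rw [ha]
    exact mul_ne_zero (hα _) (hγ _)
  refine ⟨fun z₀ hz => ?_, fun ⟨z, hz⟩ n => ?_⟩
  · have hAe : A (e 0) = b 0 • e 0 + a 1 • e 1 := by rw [he1, he0, hA0, hb]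
    have hAz : A z₀ = lam • z₀ - e 0 := by rw [← hz]; abel
    rw [map_smul, map_sub, map_smul, hAe, hAz]
    match_scalars <;> field_simp
    all_goals ring
  · let T : lp (fun _ : ℕ => ℂ) 2 →ₗ[ℂ] lp (fun _ : ℕ => ℂ) 2 :=
      lam • LinearMap.id - A.toLinearMap
    have hmem : g n ∈ LinearMap.range T :=
      mem_of_tridiagonal hα hA0 hAn lam (LinearMap.range T) (fun x => ⟨x, rfl⟩)
        ⟨z, hz.trans he0⟩ n
    rw [he]
    exact (LinearMap.range T).smul_mem _ hmem
end

section
/- If λ belongs to the resolvent set Ω(A), then, setting r_n(λ) = φ(λ) Q_n(λ) − P_n(λ), the resolvent has the matrix representation R(λ) e_n = ∑_{m=0}^∞ [Q_{min(m,n)}(λ) r_{max(m,n)}(λ) / (a_1 a_2 ⋯ a_n)] e_m for every n ≥ 0 (with the empty product a_1 ⋯ a_0 = 1). -/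
theorem ell2_add_apply (f h : lp (fun _ : ℕ => ℂ) 2) (n : ℕ) : (f + h) n = f n + h n := rfl

theorem ell2_sub_apply (f h : lp (fun _ : ℕ => ℂ) 2) (n : ℕ) : (f - h) n = f n - h n := rfl

theorem ell2_smul_apply (c : ℂ) (f : lp (fun _ : ℕ => ℂ) 2) (n : ℕ) : (c • f) n = c * f n := rfl

/-- Two continuous linear functionals on `ℓ²` agree if they agree on the standard basis. -/
theorem clm_eq_of_apply_single_one {f h : lp (fun _ : ℕ => ℂ) 2 →L[ℂ] ℂ}
    (H : ∀ n, f (lp.single 2 n (1 : ℂ)) = h (lp.single 2 n (1 : ℂ))) : f = h := by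
  refine lp.ext_continuousLinearMap (by norm_num) fun i => ?_
  ext
  simpa using H i

/-- The zeroth coordinate of the image of a vector under a tridiagonal operator. -/
theorem tridiagonal_apply_zero {α β γ : ℕ → ℂ}
    {A : lp (fun _ : ℕ => ℂ) 2 →L[ℂ] lp (fun _ : ℕ => ℂ) 2}
    {g : ℕ → lp (fun _ : ℕ => ℂ) 2} (hg : ∀ n, g n = lp.single 2 n (1 : ℂ))
    (hA0 : A (g 0) = β 0 • g 0 + α 1 • g 1)
    (hA : ∀ n, A (g (n + 1)) = γ n • g n + β (n + 1) • g (n + 1) + α (n + 2) • g (n + 2))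
    (f : lp (fun _ : ℕ => ℂ) 2) :
    A f 0 = β 0 * f 0 + γ 0 * f 1 := by
  have hgc : ∀ i j, g i j = if j = i then 1 else 0 := fun i j => by simp [hg, Pi.single_apply]
  have key : (lp.evalCLM ℂ (fun _ : ℕ => ℂ) 2 0).comp A =
      β 0 • lp.evalCLM ℂ (fun _ : ℕ => ℂ) 2 0 + γ 0 • lp.evalCLM ℂ (fun _ : ℕ => ℂ) 2 1 := by
    refine clm_eq_of_apply_single_one fun n => ?_
    rw [← hg n]
    rcases n with _ | n
    · simp [lp.evalCLM, ell2_add_apply, ell2_smul_apply, -lp.coeFn_add,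
          -lp.coeFn_smul, hA0, hgc]
    · by_cases hn : n = 0 <;> simp [lp.evalCLM, ell2_add_apply, ell2_smul_apply, -lp.coeFn_add,
          -lp.coeFn_smul, hA, hgc, hn, eq_comm]
  simpa [lp.evalCLM] using DFunLike.congr_fun key f

/-- The positive coordinates of the image of a vector under a tridiagonal operator. -/
theorem tridiagonal_apply_succ {α β γ : ℕ → ℂ}
    {A : lp (fun _ : ℕ => ℂ) 2 →L[ℂ] lp (fun _ : ℕ => ℂ) 2}
    {g : ℕ → lp (fun _ : ℕ => ℂ) 2} (hg : ∀ n, g n = lp.single 2 n (1 : ℂ))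
    (hA0 : A (g 0) = β 0 • g 0 + α 1 • g 1)
    (hA : ∀ n, A (g (n + 1)) = γ n • g n + β (n + 1) • g (n + 1) + α (n + 2) • g (n + 2))
    (f : lp (fun _ : ℕ => ℂ) 2) (m : ℕ) :
    A f (m + 1) = α (m + 1) * f m + β (m + 1) * f (m + 1) + γ (m + 1) * f (m + 2) := by
  have hgc : ∀ i j, g i j = if j = i then 1 else 0 := fun i j => by simp [hg, Pi.single_apply]
  have key : (lp.evalCLM ℂ (fun _ : ℕ => ℂ) 2 (m + 1)).comp A =
      α (m + 1) • lp.evalCLM ℂ (fun _ : ℕ => ℂ) 2 m +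
      β (m + 1) • lp.evalCLM ℂ (fun _ : ℕ => ℂ) 2 (m + 1) +
      γ (m + 1) • lp.evalCLM ℂ (fun _ : ℕ => ℂ) 2 (m + 2) := by
    refine clm_eq_of_apply_single_one fun n => ?_
    rw [← hg n]
    rcases n with _ | n
    · simp only [ContinuousLinearMap.comp_apply, hA0]
      rcases m with _ | m <;> simp [lp.evalCLM, ell2_add_apply, ell2_smul_apply, -lp.coeFn_add,
          -lp.coeFn_smul, hgc]
    · simp only [ContinuousLinearMap.comp_apply, hA]
      rcases eq_or_ne m n with rfl | h1
      · simp [lp.evalCLM, ell2_add_apply, ell2_smul_apply, -lp.coeFn_add,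
          -lp.coeFn_smul, hgc]
      rcases eq_or_ne n (m + 1) with rfl | h2
      · simp [lp.evalCLM, ell2_add_apply, ell2_smul_apply, -lp.coeFn_add,
          -lp.coeFn_smul, hgc]
        omega
      rcases eq_or_ne m (n + 1) with rfl | h3
      · simp [lp.evalCLM, ell2_add_apply, ell2_smul_apply, -lp.coeFn_add,
          -lp.coeFn_smul, hgc]
        omega
      simp [lp.evalCLM, ell2_add_apply, ell2_smul_apply, -lp.coeFn_add,
          -lp.coeFn_smul, hgc, h1, h2.symm, h3]
  simpa [lp.evalCLM] using DFunLike.congr_fun key f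

/-- The Casoratian of two solutions of a three-term recurrence is a product of coefficients. -/
theorem casoratian_eq_prod {a c q p : ℕ → ℂ} (hq0 : q 0 = 1) (hp0 : p 0 = 0) (hp1 : p 1 = 1)
    (hq : ∀ n, q (n + 2) = c (n + 1) * q (n + 1) - a (n + 1) * q n)
    (hp : ∀ n, p (n + 2) = c (n + 1) * p (n + 1) - a (n + 1) * p n) (n : ℕ) :
    q n * p (n + 1) - q (n + 1) * p n = ∏ k ∈ Finset.Icc 1 n, a k := by
  induction n with
  | zero => simp [hq0, hp0, hp1]
  | succ n ih =>
    rw [Finset.prod_Icc_succ_top (by omega), ← ih, hq, hp]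
    ring

/-- If `λ ∈ Ω(A)`, the resolvent has the matrix representation `(12)`:
`R(λ) e n = ∑' m, (Q (min m n) λ * r (max m n) / (a 1 ⋯ a n)) • e m`. -/
theorem resolvent_matrix_representation
    (α β γ : ℕ → ℂ) (hα : ∀ k, α k ≠ 0) (hγ : ∀ k, γ k ≠ 0)
    (A : lp (fun _ : ℕ => ℂ) 2 →L[ℂ] lp (fun _ : ℕ => ℂ) 2)
    (g : ℕ → lp (fun _ : ℕ => ℂ) 2) (hg : ∀ n, g n = lp.single 2 n (1 : ℂ))
    (hA0 : A (g 0) = β 0 • g 0 + α 1 • g 1)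
    (hAn : ∀ n, 1 ≤ n → A (g n) = γ (n - 1) • g (n - 1) + β n • g n + α (n + 1) • g (n + 1))
    (a b : ℕ → ℂ) (ha : ∀ n, a n = α n * γ (n - 1)) (hb : ∀ n, b n = β n)
    (d : ℕ → ℂ) (hd : ∀ n, d n = ∏ k ∈ Finset.range n, γ k)
    (e : ℕ → lp (fun _ : ℕ => ℂ) 2) (he : ∀ n, e n = (d n)⁻¹ • g n)
    (Q P : ℕ → ℂ → ℂ)
    (hQ0 : ∀ z, Q 0 z = 1) (hQ1 : ∀ z, Q 1 z = z - b 0)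
    (hP0 : ∀ z, P 0 z = 0) (hP1 : ∀ z, P 1 z = 1)
    (hQrec : ∀ n, 1 ≤ n → ∀ z, Q (n + 1) z = (z - b n) * Q n z - a n * Q (n - 1) z)
    (hPrec : ∀ n, 1 ≤ n → ∀ z, P (n + 1) z = (z - b n) * P n z - a n * P (n - 1) z)
    (lam : ℂ) (hlam : lam ∉ spectrum ℂ A)
    (R : lp (fun _ : ℕ => ℂ) 2 →L[ℂ] lp (fun _ : ℕ => ℂ) 2)
    (hR : R = Ring.inverse (algebraMap ℂ _ lam - A))
    (φ : ℂ) (hφ : φ = inner (𝕜 := ℂ) (g 0) (R (g 0)))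
    (r : ℕ → ℂ) (hr : ∀ n, r n = φ * Q n lam - P n lam) :
    ∀ n : ℕ, R (e n) =
      ∑' m : ℕ, (Q (min m n) lam * r (max m n) / ∏ k ∈ Finset.Icc 1 n, a k) • e m := by
  have hAs : ∀ n, A (g (n + 1)) = γ n • g n + β (n + 1) • g (n + 1) + α (n + 2) • g (n + 2) :=
    fun n => by simpa using hAn (n + 1) (by omega)
  have hd0 : d 0 = 1 := by simp [hd]
  have hds : ∀ n, d (n + 1) = d n * γ n := fun n => by rw [hd, hd, Finset.prod_range_succ]
  have hdne : ∀ n, d n ≠ 0 := fun n => by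
    rw [hd]; exact Finset.prod_ne_zero_iff.2 fun k _ => hγ k
  have has : ∀ n, a (n + 1) = α (n + 1) * γ n := fun n => by simp [ha]
  have hane : ∀ n, a n ≠ 0 := fun n => by rw [ha]; exact mul_ne_zero (hα _) (hγ _)
  have hprodne : ∀ n, ∏ k ∈ Finset.Icc 1 n, a k ≠ 0 := fun n =>
    Finset.prod_ne_zero_iff.2 fun k _ => hane k
  have hprods : ∀ n, ∏ k ∈ Finset.Icc 1 (n + 1), a k = (∏ k ∈ Finset.Icc 1 n, a k) * a (n + 1) :=
    fun n => Finset.prod_Icc_succ_top (by omega) _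
  have hQs : ∀ n, Q (n + 2) lam = (lam - b (n + 1)) * Q (n + 1) lam - a (n + 1) * Q n lam :=
    fun n => by simpa using hQrec (n + 1) (by omega) lam
  have hPs : ∀ n, P (n + 2) lam = (lam - b (n + 1)) * P (n + 1) lam - a (n + 1) * P n lam :=
    fun n => by simpa using hPrec (n + 1) (by omega) lam
  have hrs : ∀ n, r (n + 2) = (lam - b (n + 1)) * r (n + 1) - a (n + 1) * r n := fun n => by
    rw [hr, hr, hr, hQs, hPs]; ring
  have hW : ∀ n, Q (n + 1) lam * r n - Q n lam * r (n + 1) = ∏ k ∈ Finset.Icc 1 n, a k :=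
    fun n => by
      rw [← casoratian_eq_prod (a := a) (c := fun k => lam - b k) (q := fun k => Q k lam)
        (p := fun k => P k lam) (hQ0 _) (hP0 _) (hP1 _) hQs hPs n, hr, hr]
      ring
  have hunit : IsUnit (algebraMap ℂ (lp (fun _ : ℕ => ℂ) 2 →L[ℂ] lp (fun _ : ℕ => ℂ) 2) lam - A) :=
    spectrum.notMem_iff.1 hlam
  have hRr : ∀ f, lam • R f - A (R f) = f := fun f => by
    have := DFunLike.congr_fun (Ring.mul_inverse_cancel _ hunit) f
    rw [← hR] at this
    simpa [Algebra.algebraMap_eq_smul_one] using this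
  have hRl : ∀ f, lam • R f - R (A f) = f := fun f => by
    have := DFunLike.congr_fun (Ring.inverse_mul_cancel _ hunit) f
    rw [← hR] at this
    simpa [Algebra.algebraMap_eq_smul_one] using this
  have hge : ∀ n, g n = d n • e n := fun n => by rw [he, smul_inv_smul₀ (hdne n)]
  have hRg0 : R (g 0) 0 = φ := by
    rw [hφ, hg, lp.inner_single_left]; simp
  -- the zeroth column of the resolvent
  have hcol : ∀ m, d m * R (g 0) m = r m ∧ d (m + 1) * R (g 0) (m + 1) = r (m + 1) := by
    intro m
    induction m with
    | zero =>
      have h := congrArg (fun f : lp (fun _ : ℕ => ℂ) 2 => f 0) (hRr (g 0))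
      simp only [ell2_sub_apply, ell2_smul_apply,
        tridiagonal_apply_zero hg hA0 hAs, hRg0] at h
      have h1 : g 0 0 = 1 := by simp [hg]
      rw [h1] at h
      refine ⟨by rw [hd0, hRg0, hr, hQ0, hP0]; ring, ?_⟩
      rw [hds, hd0, hr, zero_add, hQ1, hP1, hb]
      linear_combination -h
    | succ m ih =>
      refine ⟨ih.2, ?_⟩
      have h := congrArg (fun f : lp (fun _ : ℕ => ℂ) 2 => f (m + 1)) (hRr (g 0))
      simp only [ell2_sub_apply, ell2_smul_apply,
        tridiagonal_apply_succ hg hA0 hAs] at h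
      have h1 : g 0 (m + 1) = 0 := by simp [hg]
      rw [h1] at h
      rw [hrs, ← ih.1, ← ih.2, hb, has, hds (m + 1), hds m]
      linear_combination -(d m * γ m) * h
  have hAe0 : A (e 0) = b 0 • e 0 + a 1 • e 1 := by
    have : a 1 * (d 1)⁻¹ = α 1 := by
      rw [has 0, hds 0, hd0]; field_simp [hγ 0]
    rw [he 0, he 1, hd0, hb, smul_smul _ _ (g 1), this]
    simpa using hA0
  have hAe : ∀ n, A (e (n + 1)) = e n + b (n + 1) • e (n + 1) + a (n + 2) • e (n + 2) := by
    intro n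
    have h1 : (d (n + 1))⁻¹ * γ n = (d n)⁻¹ := by
      rw [hds]; field_simp [hγ n, hdne n]
    have h2 : a (n + 2) * (d (n + 2))⁻¹ = (d (n + 1))⁻¹ * α (n + 2) := by
      rw [has (n + 1), hds (n + 1)]; field_simp [hγ (n + 1), hdne (n + 1)]
    rw [he (n + 1), he n, he (n + 2), map_smul, hAs, smul_add, smul_add, smul_smul,
      smul_smul _ _ (g (n + 2)), h1, smul_smul _ _ (g (n + 2)), h2, hb, smul_comm (β (n + 1))]
  have hee : ∀ n m, d m * e n m = if m = n then 1 else 0 := by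
    intro n m
    rw [he, hg, ell2_smul_apply]
    by_cases h : m = n
    · subst h; simp [hdne]
    · simp [h]
  have main : ∀ n, (∀ m, d m * R (e n) m =
        Q (min m n) lam * r (max m n) / ∏ k ∈ Finset.Icc 1 n, a k) ∧
      (∀ m, d m * R (e (n + 1)) m =
        Q (min m (n + 1)) lam * r (max m (n + 1)) / ∏ k ∈ Finset.Icc 1 (n + 1), a k) := by
    intro n
    induction n with
    | zero =>
      have h0 : ∀ m, d m * R (e 0) m = r m := fun m => by
        rw [← (hcol m).1, hge 0, hd0, one_smul]
      refine ⟨fun m => by simp [h0, hQ0], fun m => ?_⟩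
      have h := congrArg (fun f : lp (fun _ : ℕ => ℂ) 2 => d m * f m) (hRl (e 0))
      simp only [hAe0, map_add, map_smul, ell2_sub_apply, ell2_add_apply,
        ell2_smul_apply, hee] at h
      have h' := h0 m
      rw [eq_div_iff (hprodne _), hprods 0]
      rcases m with _ | m
      · have w := hW 0
        simp only [zero_add, hQ0, hQ1, Finset.Icc_eq_empty_of_lt zero_lt_one,
          Finset.prod_empty] at w
        simp [hQ0] at h ⊢
        linear_combination w - h + (lam - b 0) * h'
      · rw [if_neg (by omega)] at h
        simp [hQ1]
        linear_combination -h + (lam - b 0) * h'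
    | succ n ih =>
      refine ⟨ih.2, fun m => ?_⟩
      have h := congrArg (fun f : lp (fun _ : ℕ => ℂ) 2 => d m * f m) (hRl (e (n + 1)))
      simp only [hAe, map_add, map_smul, ell2_sub_apply, ell2_add_apply,
        ell2_smul_apply, hee] at h
      have h1 := ih.1 m
      have h2 := ih.2 m
      rw [eq_div_iff (hprodne _)] at h1 h2 ⊢
      have hs := hprods (n + 1)
      have hs' := hprods n
      have w := hW (n + 1)
      rw [hs]
      rw [hs'] at h2 w ⊢
      generalize ∏ k ∈ Finset.Icc 1 n, a k = p at h1 h2 w ⊢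
      have step : d m * R (e (n + 2)) m * (p * a (n + 1) * a (n + 2)) =
          (lam - b (n + 1)) * (Q (min m (n + 1)) lam * r (max m (n + 1))) -
          a (n + 1) * (Q (min m n) lam * r (max m n)) -
          (if m = n + 1 then 1 else 0) * (p * a (n + 1)) := by
        rw [← h1, ← h2]
        linear_combination -(p * a (n + 1)) * h
      refine step.trans ?_
      rcases lt_trichotomy m (n + 1) with hm | rfl | hm
      · rw [min_eq_left hm.le, max_eq_right hm.le, min_eq_left (by omega : m ≤ n),
          max_eq_right (by omega : m ≤ n), min_eq_left (by omega : m ≤ n + 1 + 1),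
          max_eq_right (by omega : m ≤ n + 1 + 1), if_neg hm.ne, hrs]
        ring
      · rw [min_self, max_self, min_eq_right (by omega : n ≤ n + 1),
          max_eq_left (by omega : n ≤ n + 1), min_eq_left (by omega : n + 1 ≤ n + 1 + 1),
          max_eq_right (by omega : n + 1 ≤ n + 1 + 1), if_pos rfl]
        rw [hQs] at w
        linear_combination w
      · rw [min_eq_right hm.le, max_eq_left hm.le, min_eq_right (by omega : n ≤ m),
          max_eq_left (by omega : n ≤ m), min_eq_right (by omega : n + 1 + 1 ≤ m),
          max_eq_left (by omega : n + 1 + 1 ≤ m), if_neg hm.ne', hQs]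
        ring
  intro n
  rw [← (lp.hasSum_single (by norm_num) (R (e n))).tsum_eq]
  congr 1
  funext m
  rw [← (main n).1 m, he m, smul_smul, mul_right_comm, mul_inv_cancel₀ (hdne m), one_mul, hg,
    ← lp.single_smul, smul_eq_mul, mul_one]
end
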